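/- Every grid function $v$ vanishing on the boundary satisfies $|v|_1\le\frac{L_1L_2}{\sqrt{6(L_1^2+L_2^2)}}\,\|\Delta_h v\|$; in particular, when $L_1=L_2=1$ this gives $|v|_1\le\frac{1}{2\sqrt{3}}\|\Delta_h v\|$. -/

import Mathlib

open Finset

/-- Squared discrete H¹ seminorm  |v|₁² = ‖δₓv‖² + ‖δ_yv‖². -/
noncomputable def gridSemiSq (h₁ h₂ : ℝ) (M₁ M₂ : ℕ) (v : ℕ → ℕ → ℝ) : ℝ :=
  h₁ * h₂ * ∑ i ∈ Finset.Icc 1 M₁, ∑ j ∈ Finset.Icc 1 (M₂ - 1),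
      ((v i j - v (i - 1) j) / h₁) ^ 2
  + h₁ * h₂ * ∑ i ∈ Finset.Icc 1 (M₁ - 1), ∑ j ∈ Finset.Icc 1 M₂,
      ((v i j - v i (j - 1)) / h₂) ^ 2

/-- Discrete Laplacian Δ_h v = δₓ²v + δ_y²v. -/
noncomputable def discreteLap (h₁ h₂ : ℝ) (v : ℕ → ℕ → ℝ) (i j : ℕ) : ℝ :=
  (v (i + 1) j - 2 * v i j + v (i - 1) j) / h₁ ^ 2
  + (v i (j + 1) - 2 * v i j + v i (j - 1)) / h₂ ^ 2

/-- Squared discrete L² norm of the discrete Laplacian. -/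
noncomputable def lapNormSq (h₁ h₂ : ℝ) (M₁ M₂ : ℕ) (v : ℕ → ℕ → ℝ) : ℝ :=
  h₁ * h₂ * ∑ i ∈ Finset.Icc 1 (M₁ - 1), ∑ j ∈ Finset.Icc 1 (M₂ - 1),
      (discreteLap h₁ h₂ v i j) ^ 2

lemma aux_Icc (n : ℕ) (f : ℕ → ℝ) :
    ∑ i ∈ Finset.Icc 1 n, f i = ∑ i ∈ Finset.range n, f (i + 1) := by
  induction n with
  | zero => simp
  | succ k ih => rw [Finset.sum_Icc_succ_top (by omega), ih, Finset.sum_range_succ]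

lemma aux_cs (u : ℕ → ℝ) (a k : ℕ) :
    (u (a + k) - u a) ^ 2 ≤ k * ∑ i ∈ Finset.range k, (u (a + i + 1) - u (a + i)) ^ 2 := by
  have h := sq_sum_le_card_mul_sum_sq (s := Finset.range k)
    (f := fun i => u (a + i + 1) - u (a + i))
  have e : ∑ i ∈ Finset.range k, (u (a + i + 1) - u (a + i)) = u (a + k) - u a :=
    Finset.sum_range_sub (fun i => u (a + i)) k
  rw [e] at h
  simpa using h

lemma aux_sum (n : ℕ) (M : ℝ) :
    ∑ i ∈ Finset.range n, ((i : ℝ) + 1) * (M - (i + 1)) =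
      M * (n * (n + 1) / 2) - n * (n + 1) * (2 * n + 1) / 6 := by
  induction n with
  | zero => simp
  | succ k ih => rw [Finset.sum_range_succ, ih]; push_cast; ring

lemma aux_poincare (u : ℕ → ℝ) (n : ℕ) (h0 : u 0 = 0) (hM : u (n + 1) = 0) :
    ∑ i ∈ Finset.range n, u (i + 1) ^ 2 ≤
      ((n : ℝ) + 1) ^ 2 / 6 * ∑ i ∈ Finset.range (n + 1), (u (i + 1) - u i) ^ 2 := by
  set D := ∑ i ∈ Finset.range (n + 1), (u (i + 1) - u i) ^ 2 with hD
  have hD0 : 0 ≤ D := Finset.sum_nonneg fun _ _ => sq_nonneg _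
  have hp : ∀ i ∈ Finset.range n, ((n : ℝ) + 1) * u (i + 1) ^ 2 ≤
      ((i : ℝ) + 1) * (((n : ℝ) + 1) - (i + 1)) * D := by
    intro i hi
    obtain ⟨k, rfl⟩ : ∃ k, n = i + k := ⟨n - i, by have := Finset.mem_range.1 hi; omega⟩
    have c1 := aux_cs u 0 (i + 1)
    have c2 := aux_cs u (i + 1) k
    have e : D = ∑ j ∈ Finset.range (i + 1), (u (0 + j + 1) - u (0 + j)) ^ 2 +
        ∑ j ∈ Finset.range k, (u (i + 1 + j + 1) - u (i + 1 + j)) ^ 2 := by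
      rw [hD, show i + k + 1 = (i + 1) + k by ring, Finset.sum_range_add]
      simp
    rw [show i + 1 + k = i + k + 1 by ring, hM] at c2
    rw [zero_add, h0] at c1
    rw [e]
    set A := ∑ j ∈ Finset.range (i + 1), (u (0 + j + 1) - u (0 + j)) ^ 2
    set B := ∑ j ∈ Finset.range k, (u (i + 1 + j + 1) - u (i + 1 + j)) ^ 2
    push_cast at c1 c2 ⊢
    have d1 := mul_le_mul_of_nonneg_left c1 (Nat.cast_nonneg (α := ℝ) k)
    have d2 := mul_le_mul_of_nonneg_left c2 (by positivity : (0 : ℝ) ≤ (i : ℝ) + 1)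
    nlinarith [d1, d2]
  have hs := Finset.sum_le_sum hp
  rw [← Finset.mul_sum, ← Finset.sum_mul, aux_sum] at hs
  have hn : (0 : ℝ) < (n : ℝ) + 1 := by positivity
  refine le_of_mul_le_mul_left (hs.trans ?_) hn
  rw [← mul_assoc]
  refine mul_le_mul_of_nonneg_right ?_ hD0
  nlinarith [hn]

lemma aux_parts (u : ℕ → ℝ) (n : ℕ) (h0 : u 0 = 0) :
    ∑ i ∈ Finset.range (n + 1), (u (i + 1) - u i) ^ 2 =
      - ∑ i ∈ Finset.range n, (u (i + 2) - 2 * u (i + 1) + u i) * u (i + 1)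
        + (u (n + 1) - u n) * u (n + 1) := by
  induction n with
  | zero => simp [h0]; ring
  | succ k ih => rw [Finset.sum_range_succ, ih, Finset.sum_range_succ]; ring

lemma aux_main (m n : ℕ) (L₁ L₂ h₁ h₂ : ℝ) (hL₁ : 0 < L₁) (hL₂ : 0 < L₂)
    (hh₁ : h₁ = L₁ / ((m : ℝ) + 1)) (hh₂ : h₂ = L₂ / ((n : ℝ) + 1))
    (v : ℕ → ℕ → ℝ) (b1 : ∀ j < n, v 0 (j + 1) = 0) (b2 : ∀ j < n, v (m + 1) (j + 1) = 0)
    (b3 : ∀ i < m, v (i + 1) 0 = 0) (b4 : ∀ i < m, v (i + 1) (n + 1) = 0) :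
    6 * (L₁ ^ 2 + L₂ ^ 2) * gridSemiSq h₁ h₂ (m + 1) (n + 1) v ≤
      (L₁ * L₂) ^ 2 * lapNormSq h₁ h₂ (m + 1) (n + 1) v := by
  have p1 : 0 < h₁ := by rw [hh₁]; positivity
  have p2 : 0 < h₂ := by rw [hh₂]; positivity
  unfold gridSemiSq lapNormSq
  simp only [aux_Icc, Nat.add_sub_cancel, div_pow, ← Finset.sum_div]
  set Q := ∑ i ∈ Finset.range m, ∑ j ∈ Finset.range n,
    discreteLap h₁ h₂ v (i + 1) (j + 1) ^ 2 with hQ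
  set X := ∑ i ∈ Finset.range (m + 1), ∑ j ∈ Finset.range n,
    (v (i + 1) (j + 1) - v i (j + 1)) ^ 2 with hX
  set Y := ∑ i ∈ Finset.range m, ∑ j ∈ Finset.range (n + 1),
    (v (i + 1) (j + 1) - v (i + 1) j) ^ 2 with hY
  set S := ∑ i ∈ Finset.range m, ∑ j ∈ Finset.range n, v (i + 1) (j + 1) ^ 2 with hS
  have hY' : S ≤ ((n : ℝ) + 1) ^ 2 / 6 * Y := by
    rw [hS, hY, Finset.mul_sum]
    refine Finset.sum_le_sum fun i hi => ?_
    have hi := Finset.mem_range.1 hi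
    exact aux_poincare (v (i + 1)) n (b3 i hi) (b4 i hi)
  have hX' : S ≤ ((m : ℝ) + 1) ^ 2 / 6 * X := by
    rw [hS, hX, Finset.sum_comm, Finset.sum_comm (s := Finset.range (m + 1)), Finset.mul_sum]
    refine Finset.sum_le_sum fun j hj => ?_
    have hj := Finset.mem_range.1 hj
    exact aux_poincare (fun i => v i (j + 1)) m (b1 j hj) (b2 j hj)
  have eY : Y = - ∑ i ∈ Finset.range m, ∑ j ∈ Finset.range n,
      (v (i + 1) (j + 2) - 2 * v (i + 1) (j + 1) + v (i + 1) j) * v (i + 1) (j + 1) := by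
    rw [hY, ← Finset.sum_neg_distrib]
    refine Finset.sum_congr rfl fun i hi => ?_
    have hi := Finset.mem_range.1 hi
    rw [aux_parts (v (i + 1)) n (b3 i hi), b4 i hi]; ring
  have eX : X = - ∑ i ∈ Finset.range m, ∑ j ∈ Finset.range n,
      (v (i + 2) (j + 1) - 2 * v (i + 1) (j + 1) + v i (j + 1)) * v (i + 1) (j + 1) := by
    rw [hX, Finset.sum_comm, Finset.sum_comm (s := Finset.range m), ← Finset.sum_neg_distrib]
    refine Finset.sum_congr rfl fun j hj => ?_
    have hj := Finset.mem_range.1 hj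
    have := aux_parts (fun i => v i (j + 1)) m (b1 j hj)
    simp only [b2 j hj] at this
    rw [this]; ring
  have hX0 : 0 ≤ X := Finset.sum_nonneg fun _ _ => Finset.sum_nonneg fun _ _ => sq_nonneg _
  have hY0 : 0 ≤ Y := Finset.sum_nonneg fun _ _ => Finset.sum_nonneg fun _ _ => sq_nonneg _
  have hQ0 : 0 ≤ Q := Finset.sum_nonneg fun _ _ => Finset.sum_nonneg fun _ _ => sq_nonneg _
  have eP : X / h₁ ^ 2 + Y / h₂ ^ 2 = - ∑ i ∈ Finset.range m, ∑ j ∈ Finset.range n,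
      discreteLap h₁ h₂ v (i + 1) (j + 1) * v (i + 1) (j + 1) := by
    rw [eX, eY, neg_div, neg_div, ← neg_add, Finset.sum_div, Finset.sum_div,
      ← Finset.sum_add_distrib]
    congr 1
    refine Finset.sum_congr rfl fun i hi => ?_
    rw [Finset.sum_div, Finset.sum_div, ← Finset.sum_add_distrib]
    refine Finset.sum_congr rfl fun j hj => ?_
    simp only [discreteLap, Nat.add_sub_cancel]
    ring
  have cs : (X / h₁ ^ 2 + Y / h₂ ^ 2) ^ 2 ≤ Q * S := by
    rw [eP, neg_sq, hQ, hS]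
    simp only [← Finset.sum_product']
    exact Finset.sum_mul_sq_le_sq_mul_sq _ _ _
  set P := X / h₁ ^ 2 + Y / h₂ ^ 2 with hP
  have hP0 : 0 ≤ P := by positivity
  have k1 : 6 * S ≤ L₁ ^ 2 * (X / h₁ ^ 2) := by
    have : L₁ ^ 2 * (X / h₁ ^ 2) = ((m : ℝ) + 1) ^ 2 * X := by rw [hh₁]; field_simp
    rw [this]; linarith
  have k2 : 6 * S ≤ L₂ ^ 2 * (Y / h₂ ^ 2) := by
    have : L₂ ^ 2 * (Y / h₂ ^ 2) = ((n : ℝ) + 1) ^ 2 * Y := by rw [hh₂]; field_simp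
    rw [this]; linarith
  have k3 : 6 * (L₁ ^ 2 + L₂ ^ 2) * S ≤ (L₁ * L₂) ^ 2 * P := by
    have d1 := mul_le_mul_of_nonneg_left k1 (sq_nonneg L₂)
    have d2 := mul_le_mul_of_nonneg_left k2 (sq_nonneg L₁)
    rw [hP]; linarith
  have k4 : 6 * (L₁ ^ 2 + L₂ ^ 2) * P ≤ (L₁ * L₂) ^ 2 * Q := by
    rcases hP0.eq_or_lt with h | h
    · rw [← h, mul_zero]; positivity
    · refine le_of_mul_le_mul_right ?_ h
      have d1 := mul_le_mul_of_nonneg_left cs (by positivity : 0 ≤ 6 * (L₁ ^ 2 + L₂ ^ 2))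
      have d2 := mul_le_mul_of_nonneg_left k3 hQ0
      linarith
  have := mul_le_mul_of_nonneg_left k4 (mul_pos p1 p2).le
  rw [hP] at this
  linarith

theorem stmt_4 (M₁ M₂ : ℕ) (hM₁ : 2 ≤ M₁) (hM₂ : 2 ≤ M₂)
    (L₁ L₂ : ℝ) (hL₁ : 0 < L₁) (hL₂ : 0 < L₂)
    (h₁ h₂ : ℝ) (hh₁ : h₁ = L₁ / M₁) (hh₂ : h₂ = L₂ / M₂)
    (v : ℕ → ℕ → ℝ)
    (hbd : ∀ i j : ℕ, i ≤ M₁ → j ≤ M₂ → (i = 0 ∨ i = M₁ ∨ j = 0 ∨ j = M₂) → v i j = 0) :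
    Real.sqrt (gridSemiSq h₁ h₂ M₁ M₂ v)
      ≤ L₁ * L₂ / Real.sqrt (6 * (L₁ ^ 2 + L₂ ^ 2)) * Real.sqrt (lapNormSq h₁ h₂ M₁ M₂ v)
    ∧ (L₁ = 1 → L₂ = 1 →
        Real.sqrt (gridSemiSq h₁ h₂ M₁ M₂ v)
          ≤ 1 / (2 * Real.sqrt 3) * Real.sqrt (lapNormSq h₁ h₂ M₁ M₂ v)) := by
  have key : 6 * (L₁ ^ 2 + L₂ ^ 2) * gridSemiSq h₁ h₂ M₁ M₂ v ≤
      (L₁ * L₂) ^ 2 * lapNormSq h₁ h₂ M₁ M₂ v := by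
    obtain ⟨m, rfl⟩ : ∃ m, M₁ = m + 1 := ⟨M₁ - 1, by omega⟩
    obtain ⟨n, rfl⟩ : ∃ n, M₂ = n + 1 := ⟨M₂ - 1, by omega⟩
    push_cast at hh₁ hh₂
    exact aux_main m n L₁ L₂ h₁ h₂ hL₁ hL₂ hh₁ hh₂ v
      (fun j hj => hbd _ _ (by omega) (by omega) (by omega))
      (fun j hj => hbd _ _ (by omega) (by omega) (by omega))
      (fun j hj => hbd _ _ (by omega) (by omega) (by omega))
      (fun j hj => hbd _ _ (by omega) (by omega) (by omega))
  have main : Real.sqrt (gridSemiSq h₁ h₂ M₁ M₂ v)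
      ≤ L₁ * L₂ / Real.sqrt (6 * (L₁ ^ 2 + L₂ ^ 2)) * Real.sqrt (lapNormSq h₁ h₂ M₁ M₂ v) := by
    have hc : 0 < 6 * (L₁ ^ 2 + L₂ ^ 2) := by positivity
    have h := Real.sqrt_le_sqrt key
    rw [Real.sqrt_mul hc.le, Real.sqrt_mul (sq_nonneg _), Real.sqrt_sq (by positivity)] at h
    rw [div_mul_eq_mul_div, le_div_iff₀ (Real.sqrt_pos.2 hc)]
    linarith
  refine ⟨main, fun e1 e2 => ?_⟩
  have h12 : Real.sqrt (6 * (L₁ ^ 2 + L₂ ^ 2)) = 2 * Real.sqrt 3 := by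
    rw [e1, e2, show (6 : ℝ) * (1 ^ 2 + 1 ^ 2) = 2 ^ 2 * 3 by norm_num,
      Real.sqrt_mul (by norm_num), Real.sqrt_sq (by norm_num)]
  rw [h12, e1, e2, one_mul] at main
  exact main
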